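/- For all natural numbers n and all k ≥ 1 there exists a natural number N with the following property: for every indexed family (f_i^j)_{i ∈ I, j < k} of functions f_i^j : ℕ → {0,1,2} with |I| = N, and every m ∈ ℕ such that (a) the set {f_i^j↾l : i ∈ I, j < k, l ≤ m} is a 2-tree, and (b) whenever i, s ∈ I and j ≠ t are indices below k with f_i^j↾m = f_s^t↾m, then f_i^j = f_s^t, there exists S ⊆ I with |S| = n such that {f_i^j↾l : i ∈ S, j < k, l ∈ ℕ} is a 2-tree. -/

import Mathlib

/-- A tree: a set of finite sequences of naturals closed under initial segments. -/
def IsTree (T : Set (List ℕ)) : Prop :=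
  ∀ σ ∈ T, ∀ n : ℕ, σ.take n ∈ T

/-- The immediate successors of a node `σ` within `T`. -/
def succs (T : Set (List ℕ)) (σ : List ℕ) : Set ℕ :=
  {m : ℕ | σ ++ [m] ∈ T}

/-- The set of all initial segments of a family of functions is a `k`-tree:
it is a tree (closed under initial segments) and every element has at most
`k` immediate successors within the set. -/
def IsInitSegKTree (k : ℕ) (T : Set (List ℕ)) : Prop :=
  IsTree T ∧ ∀ σ ∈ T, (succs T σ).encard ≤ k

/-- The initial segment `f↾n = ⟨f 0, …, f (n-1)⟩`. -/
def seg (f : ℕ → ℕ) (n : ℕ) : List ℕ :=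
  List.ofFn fun i : Fin n => f i

theorem seg_eq_seg_iff {f g : ℕ → ℕ} {l : ℕ} :
    seg f l = seg g l ↔ ∀ x < l, f x = g x := by
  simp only [seg, List.ofFn_inj, funext_iff]
  exact ⟨fun h x hx => h ⟨x, hx⟩, fun h x => h x x.2⟩

theorem length_seg (f : ℕ → ℕ) (l : ℕ) : (seg f l).length = l := by
  simp [seg]

theorem seg_succ (f : ℕ → ℕ) (l : ℕ) : seg f (l + 1) = seg f l ++ [f l] := by
  rw [seg, List.ofFn_succ_last]
  rfl

theorem take_seg (f : ℕ → ℕ) (l n : ℕ) : (seg f l).take n = seg f (min n l) := by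
  apply List.ext_getElem
  · simp [seg]
  · intro x _ _
    simp [seg]

theorem append_singleton_eq_seg {f : ℕ → ℕ} {σ : List ℕ} {p l : ℕ}
    (h : σ ++ [p] = seg f l) :
    l = σ.length + 1 ∧ σ = seg f σ.length ∧ p = f σ.length := by
  have hl : l = σ.length + 1 := by
    have := congrArg List.length h
    simpa [length_seg] using this.symm
  subst hl
  rw [seg_succ] at h
  have := List.append_inj' h rfl
  exact ⟨rfl, this.1, by simpa using this.2⟩

/-- No three members of the family `g` indexed by `S` split pairwise at the same node. -/
def NoTripleSplit {I : Type} (g : I → ℕ → ℕ) (S : Finset I) : Prop :=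
  ∀ l : ℕ, ∀ a ∈ S, ∀ b ∈ S, ∀ c ∈ S,
    (∀ x < l, g a x = g b x) → (∀ x < l, g a x = g c x) →
      g a l = g b l ∨ g a l = g c l ∨ g b l = g c l

theorem NoTripleSplit.mono {I : Type} {g : I → ℕ → ℕ} {S T : Finset I}
    (h : NoTripleSplit g T) (hST : S ⊆ T) : NoTripleSplit g S :=
  fun l a ha b hb c hc => h l a (hST ha) b (hST hb) c (hST hc)

theorem exists_noTripleSplit {I : Type} (g : I → ℕ → ℕ) (hg : ∀ i x, g i x < 3) (n : ℕ) :
    ∀ A : Finset I, 3 ^ n ≤ A.card → ∃ S ⊆ A, S.card = n ∧ NoTripleSplit g S := by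
  classical
  induction n with
  | zero => exact fun A _ => ⟨∅, by simp, rfl, by simp [NoTripleSplit]⟩
  | succ n ih =>
    intro A hA
    by_cases hconst : ∀ l, ∀ a ∈ A, ∀ b ∈ A, g a l = g b l
    · obtain ⟨S, hSA, hS⟩ := Finset.exists_subset_card_eq
        ((Nat.lt_pow_self (by norm_num : 1 < 3)).le.trans hA)
      exact ⟨S, hSA, hS, fun l a ha b hb c hc _ _ => .inl (hconst l a (hSA ha) b (hSA hb))⟩
    · have hex : ∃ l, ¬ ∀ a ∈ A, ∀ b ∈ A, g a l = g b l := not_forall.mp hconst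
      obtain ⟨l, hl, hmin⟩ : ∃ l, (¬ ∀ a ∈ A, ∀ b ∈ A, g a l = g b l) ∧
          ∀ x < l, ∀ a ∈ A, ∀ b ∈ A, g a x = g b x :=
        ⟨Nat.find hex, Nat.find_spec hex, fun x hx => not_not.mp (Nat.find_min hex hx)⟩
      obtain ⟨v, -, hv⟩ := Finset.exists_le_card_fiber_of_mul_le_card_of_maps_to
        (s := A) (t := Finset.range 3) (f := fun a => g a l) (n := 3 ^ n)
        (fun a _ => Finset.mem_range.mpr (hg a l)) (by simp)
        (by simpa [pow_succ, mul_comm] using hA)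
      obtain ⟨e, heA, hev⟩ : ∃ e ∈ A, g e l ≠ v := by
        by_contra! h
        exact hl fun a ha b hb => (h a ha).trans (h b hb).symm
      obtain ⟨S, hSB, hS, hgood⟩ := ih _ hv
      have hSv : ∀ a ∈ S, g a l = v := fun a ha => (Finset.mem_filter.mp (hSB ha)).2
      have hSA : S ⊆ A := hSB.trans (Finset.filter_subset _ _)
      have heS : e ∉ S := fun h => hev (hSv e h)
      refine ⟨insert e S, Finset.insert_subset heA hSA, by simp [heS, hS], ?_⟩
      intro x a ha b hb c hc hab hac
      rcases lt_trichotomy x l with hx | rfl | hx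
      · exact .inl (hmin x hx a (Finset.insert_subset heA hSA ha) b
          (Finset.insert_subset heA hSA hb))
      · grind
      · have h1 := hab l hx
        have h2 := hac l hx
        have h3 := hgood x a
        grind

theorem exists_forall_noTripleSplit {ι : Type} (J : Finset ι) (n : ℕ) :
    ∃ N : ℕ, ∀ (I : Type) (f : I → ι → ℕ → ℕ), (∀ i j x, f i j x < 3) →
      ∀ A : Finset I, N ≤ A.card →
        ∃ S ⊆ A, S.card = n ∧ ∀ j ∈ J, NoTripleSplit (fun i => f i j) S := by
  classical
  induction J using Finset.induction_on with
  | empty =>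
    exact ⟨n, fun I f _ A hA => by simpa using Finset.exists_subset_card_eq hA⟩
  | insert j J _ ih =>
    obtain ⟨N, hN⟩ := ih
    refine ⟨3 ^ N, fun I f hf A hA => ?_⟩
    obtain ⟨T, hTA, hT, hgood⟩ :=
      exists_noTripleSplit (fun i => f i j) (fun i x => hf i j x) N A hA
    obtain ⟨S, hST, hS, hSgood⟩ := hN I f hf T hT.ge
    refine ⟨S, hST.trans hTA, hS, fun t ht => ?_⟩
    rcases Finset.mem_insert.mp ht with rfl | ht
    · exact hgood.mono hST
    · exact hSgood t ht

theorem stmt2 (n k : ℕ) (hk : 1 ≤ k) :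
    ∃ N : ℕ, ∀ (I : Type) [Fintype I], Fintype.card I = N →
      ∀ f : I → Fin k → ℕ → ℕ, (∀ i j m, f i j m < 3) →
      ∀ m : ℕ,
        IsInitSegKTree 2
          {σ : List ℕ | ∃ i : I, ∃ j : Fin k, ∃ l ≤ m, σ = seg (f i j) l} →
        (∀ (i s : I) (j t : Fin k), j ≠ t →
          seg (f i j) m = seg (f s t) m → f i j = f s t) →
        ∃ S : Finset I, S.card = n ∧
          IsInitSegKTree 2
            {σ : List ℕ | ∃ i ∈ S, ∃ j : Fin k, ∃ l : ℕ, σ = seg (f i j) l} := by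
  obtain ⟨N, hN⟩ := exists_forall_noTripleSplit (Finset.univ : Finset (Fin k)) n
  refine ⟨N, fun I _ hI f hf m hbase hagree => ?_⟩
  obtain ⟨S, -, hS, hgood⟩ := hN I f hf Finset.univ (by simp [hI])
  refine ⟨S, hS, ?_, ?_⟩
  · rintro _ ⟨i, hi, j, l, rfl⟩ r
    exact ⟨i, hi, j, _, take_seg _ _ _⟩
  rintro σ ⟨i, -, j, l, hσ⟩
  have hl : l = σ.length := by rw [hσ, length_seg]
  subst hl
  rcases lt_or_ge σ.length m with hlt | hge
  · refine (Set.encard_le_encard ?_).trans (hbase.2 σ ⟨i, j, σ.length, hlt.le, hσ⟩)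
    rintro p ⟨s, -, t, l, h⟩
    exact ⟨s, t, l, by have := (append_singleton_eq_seg h).1; omega, h⟩
  · by_contra! hlt
    obtain ⟨P, hP, hcard⟩ := Set.exists_subset_encard_eq (Order.add_one_le_of_lt hlt)
    obtain ⟨p, q, r, hpq, hpr, hqr, rfl⟩ := Set.encard_eq_three.mp
      (hcard.trans (by norm_num))
    have branch : ∀ x ∈ ({p, q, r} : Set ℕ), ∃ a ∈ S, ∃ t, σ = seg (f a t) σ.length ∧
        x = f a t σ.length := by
      intro x hx
      obtain ⟨a, ha, t, l, h⟩ := hP hx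
      exact ⟨a, ha, t, (append_singleton_eq_seg h).2⟩
    have column_eq : ∀ {a b : I} {t u : Fin k}, σ = seg (f a t) σ.length →
        σ = seg (f b u) σ.length → f a t σ.length ≠ f b u σ.length → t = u := by
      intro a b t u ha hb hne
      by_contra htu
      have h := seg_eq_seg_iff.mp (ha.symm.trans hb)
      exact hne (congrFun (hagree a b t u htu
        (seg_eq_seg_iff.mpr fun x hx => h x (hx.trans_le hge))) _)
    obtain ⟨a, ha, t, hσa, rfl⟩ := branch p (by simp)
    obtain ⟨b, hb, u, hσb, rfl⟩ := branch q (by simp)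
    obtain ⟨c, hc, w, hσc, rfl⟩ := branch r (by simp)
    obtain rfl := column_eq hσa hσb hpq
    obtain rfl := column_eq hσa hσc hpr
    have := hgood t (Finset.mem_univ t) σ.length a ha b hb c hc
      (seg_eq_seg_iff.mp (hσa.symm.trans hσb)) (seg_eq_seg_iff.mp (hσa.symm.trans hσc))
    tauto
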